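/- arXiv:math/0405309 — 7 statements merged into one kernel-verified Lean document; each statement's English description precedes it below -/
import Mathlib

section
/- For all 0 < q < 1, 0 < a < 1, b < 1, and all n, x ∈ ℕ, the little q-Jacobi function satisfies the identity p_n^{a,b;q}(x) = ∑_{k=0}^{min(n,x)} q^{(n-k)(n-k-1)/2} (−a)^{n−k} · [(bq^k;q)_{n−k} (abq^{n−1};q)_k / ((a;q)_n (q;q)_k)] · ∏_{j=0}^{k−1}(1−q^{n−j}) · ∏_{j=0}^{k−1}(1−q^{x−j}). -/
open Finset

/-- The q-Pochhammer symbol `(c;q)_k = ∏_{j=0}^{k-1} (1 - c q^j)`. -/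
noncomputable def qPoch (q c : ℝ) (k : ℕ) : ℝ := ∏ j ∈ Finset.range k, (1 - c * q ^ j)

/-- The little q-Jacobi function
`p_n^{a,b;q}(x) = ∑_{k=0}^{n} [(q^{−n};q)_k (a b q^{n−1};q)_k / ((a;q)_k (q;q)_k)] q^{k(x+1)}`. -/
noncomputable def littleqJacobi (a b q : ℝ) (n x : ℕ) : ℝ :=
  ∑ k ∈ Finset.range (n + 1),
    qPoch q (q ^ (-(n : ℤ))) k * qPoch q (a * b * q ^ ((n : ℤ) - 1)) k
      / (qPoch q a k * qPoch q q k) * q ^ (k * (x + 1))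


lemma qPoch_succ (q c : ℝ) (k : ℕ) : qPoch q c (k+1) = qPoch q c k * (1 - c * q ^ k) := by
  simp [qPoch, prod_range_succ]

lemma qPoch_succ' (q c : ℝ) (k : ℕ) : qPoch q c (k+1) = (1 - c) * qPoch q (c * q) k := by
  unfold qPoch
  rw [prod_range_succ', mul_comm]
  simp only [pow_zero, mul_one]
  congr 1
  exact prod_congr rfl fun j _ => by ring

lemma qPoch_add (q c : ℝ) (k r : ℕ) :
    qPoch q c (k+r) = qPoch q c k * qPoch q (c * q ^ k) r := by
  unfold qPoch
  rw [prod_range_add]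
  congr 1
  exact prod_congr rfl fun j _ => by ring

lemma qPoch_ne (q c : ℝ) (hq0 : 0 < q) (hq1 : q < 1) (hc0 : 0 < c) (hc : c < 1) (k : ℕ) :
    qPoch q c k ≠ 0 := by
  refine prod_ne_zero_iff.2 fun j _ => ?_
  have h1 : q ^ j ≤ 1 := pow_le_one₀ hq0.le hq1.le
  have h2 : 0 < q ^ j := pow_pos hq0 j
  nlinarith

noncomputable def cc (q : ℝ) (n k : ℕ) : ℝ :=
  qPoch q (q ^ (-(n : ℤ))) k / qPoch q q k * q ^ k

noncomputable def gg (q : ℝ) (n k : ℕ) : ℝ :=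
  (∏ j ∈ range k, (1 - q ^ (n - j))) / qPoch q q k

noncomputable def DD (q a B : ℝ) (r : ℕ) : ℝ := ∏ i ∈ range r, (B - a * q ^ i)

noncomputable def ph (q y : ℝ) (m : ℕ) : ℝ := ∏ j ∈ range m, (1 - y * (q⁻¹) ^ j)

lemma cc_zero (q : ℝ) (n : ℕ) : cc q n 0 = 1 := by simp [cc, qPoch]
lemma gg_zero (q : ℝ) (n : ℕ) : gg q n 0 = 1 := by simp [gg, qPoch]

lemma cc_top (q : ℝ) (hq0 : 0 < q) (n : ℕ) : cc q n (n+1) = 0 := by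
  have : qPoch q (q ^ (-(n : ℤ))) (n+1) = 0 := by
    rw [qPoch_succ, zpow_neg, zpow_natCast, inv_mul_cancel₀ (pow_pos hq0 n).ne']; simp
  rw [cc, this, zero_div, zero_mul]

lemma gg_top (q : ℝ) (n : ℕ) : gg q n (n+1) = 0 := by
  simp [gg, prod_range_succ]

lemma cc_rec (q : ℝ) (hq0 : 0 < q) (hq1 : q < 1) (n k : ℕ) :
    cc q (n+1) (k+1) = (q⁻¹)^(k+1) * cc q n (k+1) - (q⁻¹)^k * cc q n k := by
  have h1 := qPoch_ne q q hq0 hq1 hq0 hq1 k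
  have h2 := qPoch_ne q q hq0 hq1 hq0 hq1 (k+1)
  unfold cc
  rw [qPoch_succ] at h2
  have h3 := right_ne_zero_of_mul h2
  rw [qPoch_succ' q (q ^ (-((n+1 : ℕ) : ℤ))), qPoch_succ q (q ^ (-(n : ℤ))), qPoch_succ q q]
  have e : (q ^ (-((n+1 : ℕ) : ℤ))) * q = q ^ (-(n : ℤ)) := by
    rw [← zpow_add_one₀ hq0.ne']; congr 1; push_cast; ring
  have e' : q ^ (-((n+1 : ℕ) : ℤ)) = q ^ (-(n : ℤ)) * q⁻¹ := by
    rw [← e]; field_simp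
  rw [e, e']
  have hq := hq0.ne'
  generalize q ^ (-(n : ℤ)) = z at *
  generalize qPoch q z k = P at *
  generalize qPoch q q k = Q at *
  rw [inv_pow, inv_pow]
  field_simp
  ring

lemma gg_rec (q : ℝ) (hq0 : 0 < q) (hq1 : q < 1) (n k : ℕ) (hk : k ≤ n) :
    gg q (n+1) (k+1) = gg q n (k+1) + q^(n-k) * gg q n k := by
  have h1 := qPoch_ne q q hq0 hq1 hq0 hq1 k
  have h2 := qPoch_ne q q hq0 hq1 hq0 hq1 (k+1)
  unfold gg
  rw [qPoch_succ] at h2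
  have h3 := right_ne_zero_of_mul h2
  rw [prod_range_succ', prod_range_succ, qPoch_succ q q]
  simp only [Nat.add_sub_add_right, Nat.sub_zero]
  obtain ⟨d, rfl⟩ := Nat.exists_eq_add_of_le hk
  rw [Nat.add_sub_cancel_left]
  generalize (∏ j ∈ range k, (1 - q ^ (k + d - j))) = P at *
  generalize qPoch q q k = Q at *
  field_simp
  ring

lemma ph_succ' (q y : ℝ) (m : ℕ) : ph q y (m+1) = (1 - y) * ph q (y * q⁻¹) m := by
  unfold ph
  rw [prod_range_succ', mul_comm]
  simp only [pow_zero, mul_one]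
  congr 1
  exact prod_congr rfl fun j _ => by ring

lemma DD_succ' (q a B : ℝ) (m : ℕ) : DD q a B (m+1) = (B - a) * DD q (a * q) B m := by
  unfold DD
  rw [prod_range_succ', mul_comm]
  simp only [pow_zero, mul_one]
  congr 1
  exact prod_congr rfl fun j _ => by ring

lemma DD_scale (q a B : ℝ) (m : ℕ) : DD q (a * q) (B * q) m = q ^ m * DD q a B m := by
  unfold DD
  rw [← card_range m, ← prod_const, card_range, ← prod_mul_distrib]
  exact prod_congr rfl fun j _ => by ring

lemma sum_split (f u v : ℕ → ℝ) (n : ℕ) (h0 : f 0 = u 0)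
    (h : ∀ k, k ≤ n → f (k+1) = u (k+1) + v k) (ht : u (n+1) = 0) :
    ∑ k ∈ range (n+1+1), f k = ∑ k ∈ range (n+1), (u k + v k) := by
  rw [sum_range_succ', sum_congr rfl fun k hk => h k (Nat.lt_succ_iff.1 (mem_range.1 hk)),
    sum_add_distrib, sum_add_distrib, h0]
  have := sum_range_succ' u (n+1)
  rw [sum_range_succ, ht] at this
  linarith

theorem key (q : ℝ) (hq0 : 0 < q) (hq1 : q < 1) (n : ℕ) : ∀ a B y : ℝ,
    ∑ k ∈ range (n+1), cc q n k * qPoch q (a * q ^ k) (n-k) * qPoch q B k * y ^ k =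
    ∑ k ∈ range (n+1), gg q n k * DD q a B (n-k) * qPoch q B k * ph q y k := by
  induction n with
  | zero => intro a B y; simp [cc, gg, qPoch, DD, ph]
  | succ n ih =>
    intro a B y
    rw [sum_split _ (fun k => cc q n k * (q⁻¹)^k * qPoch q (a * q^k) (n+1-k) * qPoch q B k * y^k)
      (fun k => - (cc q n k * (q⁻¹)^k * qPoch q (a * q^(k+1)) (n-k) * qPoch q B (k+1) * y^(k+1))),
      sum_split _ (fun k => gg q n k * DD q a B (n+1-k) * qPoch q B k * ph q y k)
      (fun k => gg q n k * q^(n-k) * DD q a B (n-k) * qPoch q B (k+1) * ph q y (k+1))]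
    · have e1 := ih (a*q) B y
      have e2 := ih (a*q) (B*q) (y*q⁻¹)
      have : ∀ s t : ℝ, s = t → s = t := fun _ _ h => h
      calc _ = (B - a) * (∑ k ∈ range (n+1), cc q n k * qPoch q (a * q * q ^ k) (n-k) * qPoch q B k * y ^ k)
            + (1-B)*(1-y)*(∑ k ∈ range (n+1), cc q n k * qPoch q (a * q * q ^ k) (n-k) * qPoch q (B*q) k * (y*q⁻¹) ^ k) := by
            rw [mul_sum, mul_sum, ← sum_add_distrib]
            refine sum_congr rfl fun k hk => ?_
            have hk' : k ≤ n := Nat.lt_succ_iff.1 (mem_range.1 hk)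
            have f1 : (1-B) * qPoch q (B*q) k = qPoch q B k * (1 - B * q^k) := by
              rw [← qPoch_succ', qPoch_succ]
            have f2 : (1-B)*(1-y)*(cc q n k * qPoch q (a * q * q ^ k) (n-k) * qPoch q (B*q) k * (y*q⁻¹) ^ k)
              = (1-y)*(cc q n k * qPoch q (a * q * q ^ k) (n-k) * (qPoch q B k * (1 - B * q^k)) * (y*q⁻¹) ^ k) := by
              rw [← f1]; ring
            rw [f2, Nat.sub_add_comm hk', qPoch_succ' q (a*q^k), qPoch_succ q B]
            have f3 : a * q^(k+1) = a * q * q^k := by ring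
            have f4 : a * q^k * q = a * q * q^k := by ring
            rw [f3, f4, mul_pow]
            have f5 : (q⁻¹)^k * q^k = 1 := by rw [← mul_pow, inv_mul_cancel₀ hq0.ne', one_pow]
            generalize qPoch q (a * q * q ^ k) (n-k) = X
            generalize qPoch q B k = Y
            generalize cc q n k = Z
            linear_combination (Z * X * Y * y^k * (B-a)) * f5
        _ = _ := by
            rw [e1, e2, mul_sum, mul_sum, ← sum_add_distrib]
            refine sum_congr rfl fun k hk => ?_
            have hk' : k ≤ n := Nat.lt_succ_iff.1 (mem_range.1 hk)
            rw [Nat.sub_add_comm hk', DD_succ', DD_scale, ph_succ', qPoch_succ' q B]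
            ring
    · simp [gg_zero]
    · intro k hk
      rw [gg_rec q hq0 hq1 n k hk, Nat.add_sub_add_right]
      ring
    · simp [gg_top]
    · simp [cc_zero]
    · intro k hk
      rw [cc_rec q hq0 hq1 n k, Nat.add_sub_add_right]
      ring
    · simp [cc_top q hq0]

lemma DD_eq (q a b : ℝ) (hq0 : 0 < q) (r k : ℕ) :
    q ^ (r * (r - 1) / 2) * (-a) ^ r * qPoch q (b * q ^ k) r
      = DD q a (a * b * q ^ (((k + r : ℕ) : ℤ) - 1)) r := by
  unfold qPoch DD
  rw [← prod_range_reflect (fun j => 1 - b * q ^ k * q ^ j), ← sum_range_id,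
    ← prod_pow_eq_pow_sum]
  nth_rewrite 2 [← card_range r]
  rw [← prod_const, ← prod_mul_distrib, ← prod_mul_distrib]
  refine prod_congr rfl fun i hi => ?_
  have hi := mem_range.1 hi
  obtain ⟨d, rfl⟩ := Nat.exists_eq_add_of_lt hi
  have : (((k + (i + d + 1) : ℕ) : ℤ) - 1) = ((k + i + d : ℕ) : ℤ) := by push_cast; ring
  rw [this, zpow_natCast]
  have : i + d + 1 - 1 - i = d := by omega
  rw [this]
  ring

lemma ph_eq (q : ℝ) (hq0 : 0 < q) (x m : ℕ) :
    ph q (q ^ x) m = ∏ j ∈ range m, (1 - q ^ (x - j)) := by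
  unfold ph
  by_cases h : m ≤ x
  · refine prod_congr rfl fun j hj => ?_
    have hj := mem_range.1 hj
    rw [pow_sub₀ q hq0.ne' (by omega), inv_pow]
  · push Not at h
    rw [prod_eq_zero (mem_range.2 h), prod_eq_zero (mem_range.2 h)]
    · simp
    · rw [← mul_pow, mul_inv_cancel₀ hq0.ne']; simp

theorem littleqJacobi_LU_series (q a b : ℝ) (hq0 : 0 < q) (hq1 : q < 1)
    (ha0 : 0 < a) (ha1 : a < 1) (hb : b < 1) (n x : ℕ) :
    littleqJacobi a b q n x =
      ∑ k ∈ Finset.range (min n x + 1),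
        q ^ ((n - k) * (n - k - 1) / 2) * (-a) ^ (n - k) *
          (qPoch q (b * q ^ k) (n - k) * qPoch q (a * b * q ^ ((n : ℤ) - 1)) k
            / (qPoch q a n * qPoch q q k)) *
          (∏ j ∈ Finset.range k, (1 - q ^ (n - j))) *
          (∏ j ∈ Finset.range k, (1 - q ^ (x - j))) := by
  have hA := qPoch_ne q a hq0 hq1 ha0 ha1
  have hext : ∀ F : ℕ → ℝ, (∑ k ∈ Finset.range (min n x + 1),
      F k * (∏ j ∈ Finset.range k, (1 - q ^ (x - j)))) =
      ∑ k ∈ Finset.range (n + 1), F k * (∏ j ∈ Finset.range k, (1 - q ^ (x - j))) := by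
    intro F
    refine sum_subset (range_mono (by omega)) fun k hk hk' => ?_
    rw [mem_range] at hk hk'
    rw [prod_eq_zero (i := x) (mem_range.2 (by omega)) (by simp), mul_zero]
  rw [hext]
  have hk := key q hq0 hq1 n a (a * b * q ^ ((n : ℤ) - 1)) (q ^ x)
  have : ∀ s t : ℝ, s * qPoch q a n = t * qPoch q a n → s = t :=
    fun s t h => mul_right_cancel₀ (hA n) h
  apply this
  unfold littleqJacobi
  rw [sum_mul, sum_mul]
  refine Eq.trans ?_ (hk.trans ?_)
  · refine sum_congr rfl fun k hk => ?_
    have hk' : k ≤ n := Nat.lt_succ_iff.1 (mem_range.1 hk)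
    have e := qPoch_add q a k (n-k)
    rw [Nat.add_sub_cancel' hk'] at e
    rw [e, cc]
    have h1 := hA k
    have h2 := qPoch_ne q q hq0 hq1 hq0 hq1 k
    field_simp
    ring
  · refine sum_congr rfl fun k hk => ?_
    have hk' : k ≤ n := Nat.lt_succ_iff.1 (mem_range.1 hk)
    have e := DD_eq q a b hq0 (n-k) k
    rw [Nat.add_sub_cancel' hk'] at e
    rw [← e, ph_eq q hq0, gg]
    have h1 := hA n
    have h2 := qPoch_ne q q hq0 hq1 hq0 hq1 k
    field_simp
end

section
/- For all 0 < a < 1, b < 1 and all m, n ∈ ℕ, the series ∑_{x=0}^{∞} p_m^{a,b;0}(x) · p_n^{a,b;0}(x) · w_x^{a,b;0} converges and equals δ_{m,n}/ω_n^{a,b;0} (Kronecker delta). -/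
open Finset

/-- The little 0-Jacobi function `p_n^{a,b;0}(x)`. -/
noncomputable def littleZeroJacobi (a b : ℝ) (n x : ℕ) : ℝ :=
  if n = 0 then 1
  else if x < n - 1 then 0
  else if x = n - 1 then (if n = 1 then -(a * (1 - b)) / (1 - a) else -a / (1 - a))
  else 1

/-- The q = 0 weight `w_x^{a,b;0}`. -/
noncomputable def littleZeroJacobiWeight (a b : ℝ) (x : ℕ) : ℝ :=
  if x = 0 then (1 - a) / (1 - a * b) else (1 - a) * (1 - b) * a ^ x / (1 - a * b)

/-- The q = 0 dual weight `ω_n^{a,b;0}`. -/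
noncomputable def littleZeroJacobiDualWeight (a b : ℝ) (n : ℕ) : ℝ :=
  if n = 0 then 1
  else if n = 1 then (1 - a) / (a * (1 - b))
  else (1 - a) * (1 - a * b) / (a ^ n * (1 - b))

theorem hasSum_step (a c S : ℝ) (ha0 : 0 < a) (ha1 : a < 1) (k : ℕ) (f : ℕ → ℝ)
    (h0 : ∀ x < k, f x = 0) (h1 : ∀ x, k < x → f x = c * a ^ x)
    (hS : f k + c * a ^ (k + 1) / (1 - a) = S) : HasSum f S := by
  rw [← hasSum_nat_add_iff' (k + 1), Finset.sum_range_succ,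
    Finset.sum_eq_zero (fun x hx => h0 x (Finset.mem_range.mp hx))]
  have hg := (hasSum_geometric_of_lt_one ha0.le ha1).mul_left (c * a ^ (k + 1))
  have he : (fun x => f (x + (k + 1))) = fun x => c * a ^ (k + 1) * a ^ x := by
    funext x
    rw [h1 _ (by omega)]
    ring
  rw [he]
  have hv : S - (0 + f k) = c * a ^ (k + 1) * (1 - a)⁻¹ := by
    rw [← hS]
    ring
  rw [hv]
  exact hg

theorem ortho_le (a b : ℝ) (ha0 : 0 < a) (ha1 : a < 1) (hb : b < 1)
    (m n : ℕ) (hmn : m ≤ n) :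
    HasSum
      (fun x : ℕ =>
        littleZeroJacobi a b m x * littleZeroJacobi a b n x * littleZeroJacobiWeight a b x)
      (if m = n then 1 / littleZeroJacobiDualWeight a b n else 0) := by
  have e1 : 1 - a ≠ 0 := by linarith
  have e2 : 1 - b ≠ 0 := by linarith
  have e3 : 1 - a * b ≠ 0 := by nlinarith
  have e4 : a ≠ 0 := ha0.ne'
  refine hasSum_step a ((1 - a) * (1 - b) / (1 - a * b)) _ ha0 ha1 (n - 1) _ ?_ ?_ ?_
  · intro x hx
    have h : littleZeroJacobi a b n x = 0 := by
      unfold littleZeroJacobi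
      rw [if_neg (by omega), if_pos hx]
    simp [h]
  · intro x hx
    have h : ∀ j ≤ n, littleZeroJacobi a b j x = 1 := by
      intro j hj
      unfold littleZeroJacobi
      split_ifs <;> first | rfl | omega
    simp only [h m hmn, h n le_rfl, littleZeroJacobiWeight]
    rw [if_neg (by omega)]
    ring
  · rcases n with _ | _ | n
    · obtain rfl : m = 0 := by omega
      simp [littleZeroJacobi, littleZeroJacobiWeight, littleZeroJacobiDualWeight]
      field_simp
      ring
    · rcases m with _ | m
      · simp [littleZeroJacobi, littleZeroJacobiWeight]
        field_simp
        ring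
      · obtain rfl : m = 0 := by omega
        simp [littleZeroJacobi, littleZeroJacobiWeight, littleZeroJacobiDualWeight]
        field_simp
        ring
    · by_cases h : m = n + 1 + 1
      · subst h
        simp [littleZeroJacobi, littleZeroJacobiWeight, littleZeroJacobiDualWeight]
        field_simp
        ring
      · have h' : littleZeroJacobi a b m (n + 1) = 1 := by
          unfold littleZeroJacobi
          split_ifs <;> first | rfl | omega
        simp [h', h]
        simp [littleZeroJacobi, littleZeroJacobiWeight]
        field_simp
        ring

theorem littleZeroJacobi_orthogonality (a b : ℝ) (ha0 : 0 < a) (ha1 : a < 1) (hb : b < 1)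
    (m n : ℕ) :
    HasSum
      (fun x : ℕ =>
        littleZeroJacobi a b m x * littleZeroJacobi a b n x * littleZeroJacobiWeight a b x)
      (if m = n then 1 / littleZeroJacobiDualWeight a b n else 0) := by
  rcases le_total m n with h | h
  · exact ortho_le a b ha0 ha1 hb m n h
  · have := ortho_le a b ha0 ha1 hb n m h
    convert this using 1
    · funext x
      ring
    · by_cases e : m = n
      · subst e
        rfl
      · rw [if_neg e, if_neg (Ne.symm e)]
end

section
/- For all 0 < a < 1, b < 1, all n ∈ ℕ and all x, y ∈ ℕ, the little 0-Jacobi functions satisfy the product formula p_n^{a,b;0}(x) · p_n^{a,b;0}(y) = ∑_{z=0}^{∞} c_{x,y,z}^{a,b,0} · p_n^{a,b;0}(z) (the series converging absolutely), where c_{x,y,z}^{a,b,0} = δ_{z,min(x,y)} if x ≠ y; c_{0,0,0}^{a,b,0} = (1−2a+ab)/(1−a); c_{0,0,z}^{a,b,0} = (1−b)a^z if z > 0; c_{x,x,z}^{a,b,0} = 0 if x > z; c_{x,x,x}^{a,b,0} = (1−2a)/(1−a) if x > 0; and c_{x,x,z}^{a,b,0} = a^{z−x} if 0 < x < z. In particular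 p_n^{a,b;0}(x) · p_n^{a,b;0}(y) = p_n^{a,b;0}(min(x,y)) whenever x ≠ y. -/
open Finset

/-- The linearization coefficients `c_{x,y,z}^{a,b,0}` of the little 0-Jacobi product
formula. -/
noncomputable def linCoeff (a b : ℝ) (x y z : ℕ) : ℝ :=
  if x ≠ y then (if z = min x y then 1 else 0)
  else if x = 0 then (if z = 0 then (1 - 2 * a + a * b) / (1 - a) else (1 - b) * a ^ z)
  else if z < x then 0
  else if z = x then (1 - 2 * a) / (1 - a)
  else a ^ (z - x)

theorem hasSum_aux (a : ℝ) (ha0 : 0 < a) (ha1 : a < 1) (f : ℕ → ℝ) (m : ℕ) (v C s : ℝ)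
    (h0 : ∀ z, z < m → f z = 0) (h1 : f m = v)
    (h2 : ∀ k, f (k + (m + 1)) = C * a ^ (k + 1)) (hs : s = v + C * a / (1 - a)) :
    HasSum f s := by
  rw [← hasSum_nat_add_iff' (m + 1), Finset.sum_range_succ,
    Finset.sum_eq_zero (fun z hz => h0 z (Finset.mem_range.mp hz)), h1, hs]
  have := (hasSum_geometric_of_lt_one ha0.le ha1).mul_left (C * a)
  have e1 : (fun k => f (k + (m + 1))) = fun i => C * a * a ^ i := by
    funext k
    rw [h2]; ring
  have e2 : v + C * a / (1 - a) - (0 + v) = C * a * (1 - a)⁻¹ := by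
    rw [div_eq_mul_inv]; ring
  rw [e1, e2]
  exact this

theorem prod_ne_aux (a b : ℝ) (n x y : ℕ) (h : x < y) :
    littleZeroJacobi a b n x * littleZeroJacobi a b n y = littleZeroJacobi a b n x := by
  by_cases hn : n = 0
  · simp [littleZeroJacobi, hn]
  by_cases hx : x < n - 1
  · simp [littleZeroJacobi, hn, hx]
  · have : littleZeroJacobi a b n y = 1 := by
      unfold littleZeroJacobi
      rw [if_neg hn, if_neg (by omega), if_neg (by omega)]
    rw [this, mul_one]

theorem prod_ne_aux' (a b : ℝ) (n x y : ℕ) (h : x ≠ y) :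
    littleZeroJacobi a b n x * littleZeroJacobi a b n y = littleZeroJacobi a b n (min x y) := by
  rcases lt_or_gt_of_ne h with h | h
  · rw [prod_ne_aux a b n x y h, min_eq_left h.le]
  · rw [mul_comm, prod_ne_aux a b n y x h, min_eq_right h.le]

theorem p_big (a b : ℝ) (n x : ℕ) (h : n ≤ x) : littleZeroJacobi a b n x = 1 := by
  unfold littleZeroJacobi
  split_ifs <;> first | rfl | omega

theorem p_small (a b : ℝ) (n x : ℕ) (h : x + 1 < n) : littleZeroJacobi a b n x = 0 := by
  unfold littleZeroJacobi
  rw [if_neg (by omega), if_pos (by omega)]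

theorem p_mid (a b : ℝ) (x : ℕ) (h : x ≠ 0) :
    littleZeroJacobi a b (x + 1) x = -a / (1 - a) := by
  simp [littleZeroJacobi, h]

theorem p_one (a b : ℝ) : littleZeroJacobi a b 1 0 = -(a * (1 - b)) / (1 - a) := by
  simp [littleZeroJacobi]

theorem c_zero (a b : ℝ) : linCoeff a b 0 0 0 = (1 - 2 * a + a * b) / (1 - a) := by
  simp [linCoeff]

theorem c_zero_pos (a b : ℝ) (z : ℕ) (h : z ≠ 0) : linCoeff a b 0 0 z = (1 - b) * a ^ z := by
  simp [linCoeff, h]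

theorem c_lt (a b : ℝ) (x z : ℕ) (h : z < x) : linCoeff a b x x z = 0 := by
  have : x ≠ 0 := by omega
  simp [linCoeff, h, this]

theorem c_self (a b : ℝ) (x : ℕ) (h : x ≠ 0) : linCoeff a b x x x = (1 - 2 * a) / (1 - a) := by
  simp [linCoeff, h]

theorem c_gt (a b : ℝ) (x k : ℕ) (h : x ≠ 0) :
    linCoeff a b x x (x + k + 1) = a ^ (k + 1) := by
  unfold linCoeff
  rw [if_neg (by simp), if_neg h, if_neg (by omega), if_neg (by omega)]
  congr 1; omega

theorem hasSum_diag (a b : ℝ) (ha0 : 0 < a) (ha1 : a < 1) (n x : ℕ) :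
    HasSum (fun z : ℕ => linCoeff a b x x z * littleZeroJacobi a b n z)
      (littleZeroJacobi a b n x * littleZeroJacobi a b n x) := by
  have h1a : (1 - a) ≠ 0 := by linarith
  by_cases hx : x = 0
  · subst hx
    by_cases hn : n ≤ 1
    · refine hasSum_aux a ha0 ha1 _ 0 _ (1 - b) _ (by intro z hz; omega) rfl ?_ ?_
      · intro k
        rw [p_big a b n _ (by omega), c_zero_pos a b _ (by omega)]; simp
      · rw [c_zero]
        interval_cases n
        · rw [p_big a b 0 0 le_rfl]; field_simp; ring
        · rw [p_one]; field_simp; ring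
    · obtain ⟨m, rfl⟩ : ∃ m, n = m + 2 := ⟨n - 2, by omega⟩
      refine hasSum_aux a ha0 ha1 _ (m + 1) _ ((1 - b) * a ^ (m + 1)) _ ?_ rfl ?_ ?_
      · intro z hz
        rw [p_small a b _ z (by omega), mul_zero]
      · intro k
        rw [p_big a b _ _ (by omega), c_zero_pos a b _ (by omega)]; ring
      · rw [p_small a b _ 0 (by omega), p_mid a b (m + 1) (by omega), c_zero_pos a b _ (by omega)]
        field_simp; ring
  · by_cases hn : n ≤ x + 1
    · refine hasSum_aux a ha0 ha1 _ x _ 1 _ ?_ rfl ?_ ?_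
      · intro z hz
        rw [c_lt a b x z hz, zero_mul]
      · intro k
        rw [p_big a b n _ (by omega), show k + (x + 1) = x + k + 1 by omega, c_gt a b x k hx]; ring
      · rw [c_self a b x hx]
        rcases Nat.lt_or_ge x n with h | h
        · obtain rfl : n = x + 1 := by omega
          rw [p_mid a b x hx]; field_simp; ring
        · rw [p_big a b n x h]; field_simp; ring
    · obtain ⟨m, rfl⟩ : ∃ m, n = x + m + 1 + 1 := ⟨n - x - 2, by omega⟩
      refine hasSum_aux a ha0 ha1 _ (x + m + 1) _ (a ^ (m + 1)) _ ?_ rfl ?_ ?_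
      · intro z hz
        rw [p_small a b _ z (by omega), mul_zero]
      · intro k
        rw [p_big a b _ _ (by omega),
          show k + (x + m + 1 + 1) = x + (k + m + 1) + 1 by omega, c_gt a b x _ hx]
        ring
      · rw [p_small a b _ x (by omega), p_mid a b (x + m + 1) (by omega), c_gt a b x m hx]
        field_simp; ring

theorem littleZeroJacobi_product_formula (a b : ℝ) (ha0 : 0 < a) (ha1 : a < 1) (hb : b < 1)
    (n x y : ℕ) :
    (Summable fun z : ℕ => |linCoeff a b x y z * littleZeroJacobi a b n z|) ∧
    HasSum (fun z : ℕ => linCoeff a b x y z * littleZeroJacobi a b n z)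
      (littleZeroJacobi a b n x * littleZeroJacobi a b n y) ∧
    (x ≠ y →
      littleZeroJacobi a b n x * littleZeroJacobi a b n y =
        littleZeroJacobi a b n (min x y)) := by
  have key : HasSum (fun z : ℕ => linCoeff a b x y z * littleZeroJacobi a b n z)
      (littleZeroJacobi a b n x * littleZeroJacobi a b n y) := by
    by_cases h : x = y
    · subst h
      exact hasSum_diag a b ha0 ha1 n x
    · rw [prod_ne_aux' a b n x y h]
      convert hasSum_single (min x y) ?_ using 1
      · simp [linCoeff, h]
      · intro z hz
        simp only [linCoeff, ne_eq, h, not_false_eq_true, if_true, if_neg hz, zero_mul]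
  exact ⟨key.summable.abs, key, prod_ne_aux' a b n x y⟩
end

section
/- Let 0 < a < 1 and b < 1, and let c_{x,y,z}^{a,b,0} be the linearization coefficients of the little 0-Jacobi product formula: c_{x,y,z}^{a,b,0} = δ_{z,min(x,y)} if x ≠ y; c_{0,0,0}^{a,b,0} = (1−2a+ab)/(1−a); c_{0,0,z}^{a,b,0} = (1−b)a^z if z > 0; c_{x,x,z}^{a,b,0} = 0 if x > z; c_{x,x,x}^{a,b,0} = (1−2a)/(1−a) if x > 0; and c_{x,x,z}^{a,b,0} = a^{z−x} if 0 < x < z. Then c_{x,y,z}^{a,b,0} ≥ 0 for all x, y, z ∈ ℕ if and only if 0 < a ≤ 1/2 and 2 − a^{−1} ≤ b < 1. -/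
open Finset

theorem linCoeff_nonneg_iff (a b : ℝ) (ha0 : 0 < a) (ha1 : a < 1) (hb : b < 1) :
    (∀ x y z : ℕ, 0 ≤ linCoeff a b x y z) ↔
      (0 < a ∧ a ≤ 1 / 2 ∧ 2 - a⁻¹ ≤ b ∧ b < 1) := by
  have h1 : 0 < 1 - a := by linarith
  have key : 2 - a⁻¹ ≤ b ↔ 0 ≤ 1 - 2 * a + a * b := by
    have e : 1 - 2 * a + a * b = a * (b - (2 - a⁻¹)) := by
      field_simp
      ring
    rw [e, mul_nonneg_iff_of_pos_left ha0, sub_nonneg]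
  constructor
  · intro h
    have h0 := h 0 0 0
    have h2 := h 1 1 1
    simp only [linCoeff, ne_eq, not_true_eq_false, if_false, if_true, one_ne_zero,
      lt_irrefl] at h0 h2
    rw [le_div_iff₀ h1, zero_mul] at h0 h2
    exact ⟨ha0, by linarith, key.2 h0, hb⟩
  · rintro ⟨-, h2, h3, -⟩ x y z
    have h4 := key.1 h3
    have h5 : 0 ≤ 1 - 2 * a := by linarith
    have h6 : 0 ≤ 1 - b := by linarith
    unfold linCoeff
    split_ifs <;> positivity
end

section
/- Let N ∈ ℕ and let y_0, y_1, …, y_N be pairwise distinct complex numbers. Define the (N+1)×(N+1) matrix C by C_{m,n} = ∏_{j=0}^{m−1}(y_j − y_n) (so C is upper triangular, since C_{m,n} = 0 for m > n), and define the matrix D by D_{k,n} = ∏_{j=0, j≠k}^{n} (y_j − y_k)^{−1} for k ≤ n, and D_{k,n} = 0 for k > n. Then C · D = I, i.e., D = C^{−1}. Equivalently, for all m ≤ n ≤ N: ∑_{k=m}^{n} [∏_{j=0}^{m−1}(y_j − y_k)] · [∏_{j=0, j≠k}^{n}(y_j − y_k)^{−1}] = δ_{m,n} (Kronecker delta). 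-/
open Finset Matrix

lemma full_sum (N : ℕ) (y : ℕ → ℂ)
    (hy : ∀ i ≤ N, ∀ j ≤ N, y i = y j → i = j) (m n : ℕ) (hmn : m ≤ n) (hn : n ≤ N) :
    ∑ k ∈ Finset.range (n + 1),
          (∏ j ∈ Finset.range m, (y j - y k)) *
            ∏ j ∈ (Finset.range (n + 1)).erase k, (y j - y k)⁻¹ =
        if m = n then 1 else 0 := by
  have hv : Set.InjOn (fun i => - y i) (Finset.range (n + 1) : Set ℕ) := by
    intro i hi j hj h
    simp only [Finset.coe_range, Set.mem_Iio] at hi hj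
    exact hy i (by omega) j (by omega) (neg_injective h)
  have hd : (Lagrange.nodal (Finset.range m) (fun i => - y i)).degree
      < #(Finset.range (n + 1)) := by
    rw [Lagrange.degree_nodal]
    simp only [Finset.card_range]
    exact_mod_cast Nat.lt_succ_of_le hmn
  have h := Lagrange.coeff_eq_sum hv hd
  have hc : (Lagrange.nodal (Finset.range m) (fun i => - y i)).coeff n
      = if m = n then 1 else 0 := by
    split_ifs with e
    · have h1 := (Lagrange.nodal_monic (s := Finset.range m) (v := fun i => - y i)).coeff_natDegree
      rw [Lagrange.natDegree_nodal, Finset.card_range] at h1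
      rw [← e]; exact h1
    · apply Polynomial.coeff_eq_zero_of_natDegree_lt
      rw [Lagrange.natDegree_nodal, Finset.card_range]
      omega
  simp only [Finset.card_range, Nat.add_sub_cancel] at h
  rw [← hc, h]
  refine Finset.sum_congr rfl fun k _ => ?_
  rw [Lagrange.eval_nodal, div_eq_mul_inv, Finset.prod_inv_distrib]
  simp only [sub_neg_eq_add, neg_add_eq_sub]

lemma low_prod (y : ℕ → ℂ) {k m : ℕ} (h : k < m) :
    ∏ j ∈ Finset.range m, (y j - y k) = 0 :=
  Finset.prod_eq_zero (Finset.mem_range.2 h) (sub_self _)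

theorem triangular_vandermonde_inverse (N : ℕ) (y : ℕ → ℂ)
    (hy : ∀ i ≤ N, ∀ j ≤ N, y i = y j → i = j) :
    (Matrix.of fun m n : Fin (N + 1) =>
        ∏ j ∈ Finset.range (m : ℕ), (y j - y (n : ℕ))) *
      (Matrix.of fun k n : Fin (N + 1) =>
        if (k : ℕ) ≤ (n : ℕ) then
          ∏ j ∈ (Finset.range ((n : ℕ) + 1)).erase (k : ℕ), (y j - y (k : ℕ))⁻¹
        else 0) = 1 ∧
    ∀ m n : ℕ, m ≤ n → n ≤ N →
      ∑ k ∈ Finset.Icc m n,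
          (∏ j ∈ Finset.range m, (y j - y k)) *
            ∏ j ∈ (Finset.range (n + 1)).erase k, (y j - y k)⁻¹ =
        if m = n then 1 else 0 := by
  constructor
  · ext m n
    rw [Matrix.mul_apply, Matrix.one_apply]
    simp only [Matrix.of_apply]
    rw [Fin.sum_univ_eq_sum_range (fun k => (∏ j ∈ Finset.range (m : ℕ), (y j - y k)) *
      if k ≤ (n : ℕ) then ∏ j ∈ (Finset.range ((n : ℕ) + 1)).erase k, (y j - y k)⁻¹ else 0)]
    have hn := n.isLt
    rcases le_or_gt (m : ℕ) n with hmn | hmn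
    · have h := full_sum N y hy m n hmn (by omega)
      simp only [Fin.ext_iff]
      rw [← h]
      symm
      rw [← Finset.sum_subset (Finset.range_subset_range.2 (show (n : ℕ) + 1 ≤ N + 1 by omega))]
      · refine Finset.sum_congr rfl fun k hk => ?_
        rw [if_pos (by simp at hk; omega)]
      · intro k _ hk
        rw [if_neg (by simp at hk; omega), mul_zero]
    · rw [if_neg (by rintro rfl; omega)]
      refine Finset.sum_eq_zero fun k _ => ?_
      split_ifs with hk
      · rw [low_prod y (by omega), zero_mul]
      · rw [mul_zero]
  · intro m n hmn hn
    rw [← full_sum N y hy m n hmn hn]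
    refine Finset.sum_subset (fun k hk => ?_) (fun k hk hk' => ?_)
    · simp at hk ⊢; omega
    · rw [low_prod y (by simp at hk hk'; omega), zero_mul]
end

section
/- Let N ∈ ℕ, let y_0, …, y_N be pairwise distinct real numbers and z_0, …, z_N be pairwise distinct real numbers. Suppose for each n ∈ {0,…,N} there is a real polynomial p_n of degree exactly n, and for each x ∈ {0,…,N} a real polynomial r_x of degree exactly x, such that p_n(y_x) = r_x(z_n) for all n, x ∈ {0,…,N}. Then there exist nonzero real numbers δ_0, …, δ_N such that p_n(y_x) = ∑_{k=0}^{min(n,x)} δ_k · ∏_{i=0}^{k−1}(z_i − z_n) · ∏_{j=0}^{k−1}(y_j − y_x) for all n, x ∈ {0,…,N}. -/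
open Finset Polynomial

lemma aux_deg (a : ℝ) (q : Polynomial ℝ) : (C a * q).degree ≤ q.degree := by
  by_cases h : a = 0
  · simp [h]
  · rw [degree_C_mul h]

lemma aux_newton (m : ℕ) (y c : ℕ → ℝ) (hy : ∀ i ≤ m, ∀ j ≤ m, y i = y j → i = j)
    (p : Polynomial ℝ) (hp : p.degree = (m : ℕ))
    (h : ∀ j < m, p.eval (y j) = ∑ k ∈ range m, c k * ∏ i ∈ range k, (y i - y j)) :
    ∃ a : ℝ, a ≠ 0 ∧ ∀ t, p.eval t =
      ∑ k ∈ range m, c k * ∏ i ∈ range k, (y i - t) + a * ∏ i ∈ range m, (y i - t) := by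
  have hWd : ∀ k, (∏ i ∈ range k, (C (y i) - X) : Polynomial ℝ).degree ≤ (k : ℕ) := by
    intro k
    refine (Polynomial.degree_prod_le _ _).trans ?_
    refine (Finset.sum_le_card_nsmul _ _ 1 ?_).trans ?_
    · intro i _
      exact (degree_sub_le _ _).trans (max_le (degree_C_le.trans (by norm_num)) degree_X_le)
    · simp
  have hWe : ∀ k t, (∏ i ∈ range k, (C (y i) - X) : Polynomial ℝ).eval t
      = ∏ i ∈ range k, (y i - t) := by
    intro k t
    simp [eval_prod]
  set S : Polynomial ℝ := ∑ k ∈ range m, C (c k) * ∏ i ∈ range k, (C (y i) - X) with hS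
  have hSd : S.degree < (m : ℕ) := by
    refine (Polynomial.degree_sum_le _ _).trans_lt ?_
    rw [Finset.sup_lt_iff (by exact WithBot.bot_lt_coe m)]
    intro k hk
    refine (aux_deg _ _).trans_lt ((hWd k).trans_lt ?_)
    exact_mod_cast mem_range.1 hk
  have hSe : ∀ t, S.eval t = ∑ k ∈ range m, c k * ∏ i ∈ range k, (y i - t) := by
    intro t
    simp [hS, eval_finsetSum, hWe]
  have hqd : (p - S).degree = (m : ℕ) := by
    rw [degree_sub_eq_left_of_degree_lt (by rw [hp]; exact hSd), hp]
  have hinj : Set.InjOn y (range (m+1)) := by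
    intro i hi j hj hij
    simp only [coe_range, Set.mem_Iio] at hi hj
    exact hy i (by omega) j (by omega) hij
  have hq0 : ∀ j < m, (p - S).eval (y j) = 0 := by
    intro j hj
    rw [eval_sub, hSe, h j hj, sub_self]
  have key : ∀ q : Polynomial ℝ, q.degree ≤ (m : ℕ) → (∀ j ≤ m, q.eval (y j) = 0) → q = 0 := by
    intro q hq h0
    refine eq_zero_of_degree_lt_of_eval_index_eq_zero (s := range (m+1)) (v := y) hinj ?_ ?_
    · refine hq.trans_lt ?_
      rw [card_range]
      exact_mod_cast Nat.lt_succ_self m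
    · intro i hi
      exact h0 i (by have := mem_range.1 hi; omega)
  have hWm : ∏ i ∈ range m, (y i - y m) ≠ 0 := by
    rw [Finset.prod_ne_zero_iff]
    intro i hi
    have hi := mem_range.1 hi
    rw [sub_ne_zero]
    intro e
    have := hy i hi.le m le_rfl e
    omega
  have hqm : (p - S).eval (y m) ≠ 0 := by
    intro e
    have := key _ hqd.le (by
      intro j hj
      rcases hj.lt_or_eq with hj | rfl
      · exact hq0 j hj
      · exact e)
    rw [this] at hqd
    simp at hqd
  refine ⟨(p - S).eval (y m) / ∏ i ∈ range m, (y i - y m), div_ne_zero hqm hWm, ?_⟩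
  set a := (p - S).eval (y m) / ∏ i ∈ range m, (y i - y m) with ha
  have := key (p - S - C a * ∏ i ∈ range m, (C (y i) - X)) (by
      refine (degree_sub_le _ _).trans (max_le hqd.le ((aux_deg _ _).trans (hWd m)))) (by
    intro j hj
    rw [eval_sub, eval_mul, eval_C, hWe]
    rcases hj.lt_or_eq with hj | rfl
    · rw [hq0 j hj, Finset.prod_eq_zero (mem_range.2 hj) (sub_self _)]
      simp
    · rw [ha, div_mul_cancel₀ _ hWm, sub_self])
  intro t
  have h2 := congrArg (eval t) this
  rw [eval_sub, eval_mul, eval_C, hWe, eval_sub, hSe, eval_zero] at h2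
  linarith

lemma aux_prod_ne (m : ℕ) (y : ℕ → ℝ) (hy : ∀ i ≤ m, ∀ j ≤ m, y i = y j → i = j) :
    ∏ i ∈ range m, (y i - y m) ≠ 0 := by
  rw [Finset.prod_ne_zero_iff]
  intro i hi
  have hi := mem_range.1 hi
  rw [sub_ne_zero]
  intro e
  have := hy i hi.le m le_rfl e
  omega

theorem dual_orthogonal_polynomials_LDU (N : ℕ) (y z : ℕ → ℝ)
    (hy : ∀ i ≤ N, ∀ j ≤ N, y i = y j → i = j)
    (hz : ∀ i ≤ N, ∀ j ≤ N, z i = z j → i = j)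
    (p r : ℕ → Polynomial ℝ)
    (hp : ∀ n ≤ N, (p n).degree = (n : ℕ))
    (hr : ∀ x ≤ N, (r x).degree = (x : ℕ))
    (hdual : ∀ n ≤ N, ∀ x ≤ N, (p n).eval (y x) = (r x).eval (z n)) :
    ∃ δ : ℕ → ℝ, (∀ k ≤ N, δ k ≠ 0) ∧
      ∀ n ≤ N, ∀ x ≤ N,
        (p n).eval (y x) =
          ∑ k ∈ Finset.range (min n x + 1),
            δ k * (∏ i ∈ Finset.range k, (z i - z n)) *
              ∏ j ∈ Finset.range k, (y j - y x) := by
  have main : ∀ m ≤ N + 1, ∃ δ : ℕ → ℝ, (∀ k < m, δ k ≠ 0) ∧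
      ∀ n ≤ N, ∀ x ≤ N, min n x < m → (p n).eval (y x) =
          ∑ k ∈ Finset.range m, δ k * (∏ i ∈ Finset.range k, (z i - z n)) *
              ∏ j ∈ Finset.range k, (y j - y x) := by
    intro m
    induction m with
    | zero => intro _; exact ⟨fun _ => 1, by simp, by simp⟩
    | succ m ih =>
      intro hm
      obtain ⟨δ, hδ, H⟩ := ih (by omega)
      have hmN : m ≤ N := by omega
      have hym : ∀ i ≤ m, ∀ j ≤ m, y i = y j → i = j :=
        fun i hi j hj => hy i (by omega) j (by omega)
      have hzm : ∀ i ≤ m, ∀ j ≤ m, z i = z j → i = j :=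
        fun i hi j hj => hz i (by omega) j (by omega)
      obtain ⟨a, ha, hA⟩ := aux_newton m y (fun k => δ k * ∏ i ∈ range k, (z i - z m)) hym
        (p m) (hp m hmN) (fun j hj => H m hmN j (by omega) (by omega))
      obtain ⟨b, hb, hB⟩ := aux_newton m z (fun k => δ k * ∏ i ∈ range k, (y i - y m)) hzm
        (r m) (hr m hmN) (fun j hj => by
          rw [← hdual j (by omega) m hmN, H j (by omega) m hmN (by omega)]
          exact Finset.sum_congr rfl fun k _ => by ring)
      have hY := aux_prod_ne m y hym
      have hZ := aux_prod_ne m z hzm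
      have hab : a * ∏ i ∈ range m, (y i - y m) = b * ∏ i ∈ range m, (z i - z m) := by
        have h1 := hA (y m)
        have h2 := hB (z m)
        rw [hdual m hmN m hmN, h2] at h1
        have h3 : ∑ k ∈ range m, (δ k * ∏ i ∈ range k, (y i - y m)) * ∏ i ∈ range k, (z i - z m)
          = ∑ k ∈ range m, (δ k * ∏ i ∈ range k, (z i - z m)) * ∏ i ∈ range k, (y i - y m) :=
          Finset.sum_congr rfl fun k _ => by ring
        linarith
      refine ⟨fun k => if k = m then a / ∏ i ∈ range m, (z i - z m) else δ k, ?_, ?_⟩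
      · intro k hk
        by_cases h : k = m
        · simp only [h, if_true]
          exact div_ne_zero ha hZ
        · simp only [h, if_false]
          exact hδ k (by omega)
      · intro n hn x hx hnx
        have hsum : ∑ k ∈ range m, (if k = m then a / ∏ i ∈ range m, (z i - z m) else δ k) *
            (∏ i ∈ range k, (z i - z n)) * ∏ j ∈ range k, (y j - y x) =
            ∑ k ∈ range m, δ k * (∏ i ∈ range k, (z i - z n)) * ∏ j ∈ range k, (y j - y x) := by
          refine Finset.sum_congr rfl fun k hk => ?_
          rw [if_neg (mem_range.1 hk).ne]
        rw [Finset.sum_range_succ, hsum]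
        simp only [if_true]
        by_cases hlt : min n x < m
        · rw [H n hn x hx hlt]
          rcases min_lt_iff.1 hlt with h | h
          · rw [Finset.prod_eq_zero (f := fun i => z i - z n) (mem_range.2 h) (sub_self _)]
            simp
          · rw [Finset.prod_eq_zero (f := fun i => y i - y x) (mem_range.2 h) (sub_self _)]
            simp
        · have hc : n = m ∨ x = m := by omega
          rcases hc with rfl | rfl
          · rw [hA, div_mul_cancel₀ _ hZ]
          · rw [hdual n hn x hx, hB]
            congr 1
            · exact Finset.sum_congr rfl fun k _ => by ring
            · field_simp
              linear_combination (-∏ i ∈ range x, (z i - z n)) * hab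
  obtain ⟨δ, hδ, H⟩ := main (N + 1) le_rfl
  refine ⟨δ, fun k hk => hδ k (by omega), fun n hn x hx => ?_⟩
  rw [H n hn x hx (by omega)]
  symm
  refine Finset.sum_subset (Finset.range_mono (by omega)) ?_
  intro k _ hk
  have hk : min n x < k := by
    rw [mem_range] at hk
    omega
  rcases min_lt_iff.1 hk with h | h
  · rw [Finset.prod_eq_zero (f := fun i => z i - z n) (mem_range.2 h) (sub_self _)]
    simp
  · rw [Finset.prod_eq_zero (f := fun i => y i - y x) (mem_range.2 h) (sub_self _)]
    simp
end

section
/- Let N ∈ ℕ, let z_0, …, z_N be pairwise distinct real numbers, let y_0, …, y_N be real numbers, let δ_0, …, δ_N be real numbers, and define for each n ∈ {0,…,N} the polynomial p_n(y) = ∑_{k=0}^{n} δ_k · ∏_{i=0}^{k−1}(z_i − z_n) · ∏_{j=0}^{k−1}(y_j − y). Then for every m ∈ {0,…,N} and every real number y_ν with y_ν ≠ y_j for all j < m, one has δ_m = [∏_{j=0}^{m−1}(y_j − y_ν)]^{−1} · ∑_{n=0}^{m} p_n(y_ν) · ∏_{i=0, i≠n}^{m}(z_i − z_n)^{−1}.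 -/
open Finset

theorem delta_coefficients_formula (N : ℕ) (y z δ : ℕ → ℝ)
    (hz : ∀ i ≤ N, ∀ j ≤ N, i ≠ j → z i ≠ z j)
    (m : ℕ) (hm : m ≤ N) (yν : ℝ) (hyν : ∀ j < m, yν ≠ y j) :
    δ m =
      (∏ j ∈ Finset.range m, (y j - yν))⁻¹ *
        ∑ n ∈ Finset.range (m + 1),
          (∑ k ∈ Finset.range (n + 1),
              δ k * (∏ i ∈ Finset.range k, (z i - z n)) *
                ∏ j ∈ Finset.range k, (y j - yν)) *
            ∏ i ∈ (Finset.range (m + 1)).erase n, (z i - z n)⁻¹ := by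
  set Y : ℕ → ℝ := fun k => ∏ j ∈ Finset.range k, (y j - yν) with hY
  have hY0 : Y m ≠ 0 := by
    refine Finset.prod_ne_zero_iff.2 fun j hj => ?_
    exact sub_ne_zero.2 (hyν j (Finset.mem_range.1 hj)).symm
  let v : ℕ → ℝ := fun i => - z i
  have hv : Set.InjOn v (Finset.range (m + 1)) := by
    intro i hi j hj hij
    by_contra hne
    have hi' : i < m + 1 := by simpa using hi
    have hj' : j < m + 1 := by simpa using hj
    exact hz i (by omega) j (by omega) hne (neg_injective hij)
  let P : Polynomial ℝ := ∑ k ∈ Finset.range (m + 1),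
    Polynomial.C (δ k * Y k) * Lagrange.nodal (Finset.range k) v
  have hdeg : P.degree < ((m + 1 : ℕ) : WithBot ℕ) := by
    refine Polynomial.degree_sum_le _ _ |>.trans_lt ?_
    refine (Finset.sup_lt_iff (WithBot.bot_lt_coe _)).2 fun k hk => ?_
    rw [← Polynomial.smul_eq_C_mul]
    refine (Polynomial.degree_smul_le _ _).trans_lt ?_
    rw [Lagrange.degree_nodal, Finset.card_range]
    exact_mod_cast Finset.mem_range.1 hk
  have hcoeff : P.coeff m = δ m * Y m := by
    simp only [P, Polynomial.finsetSum_coeff, Polynomial.coeff_C_mul]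
    rw [Finset.sum_range_succ, Finset.sum_eq_zero, zero_add]
    · have h := (Lagrange.nodal_monic (s := Finset.range m) (v := v)).coeff_natDegree
      rw [Lagrange.natDegree_nodal, Finset.card_range] at h
      rw [h, mul_one]
    · intro k hk
      rw [Polynomial.coeff_eq_zero_of_natDegree_lt, mul_zero]
      rw [Lagrange.natDegree_nodal, Finset.card_range]
      exact Finset.mem_range.1 hk
  have heval : ∀ n ∈ Finset.range (m + 1), P.eval (v n) =
      ∑ k ∈ Finset.range (n + 1), δ k * (∏ i ∈ Finset.range k, (z i - z n)) * Y k := by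
    intro n hn
    simp only [P, Polynomial.eval_finsetSum, Polynomial.eval_mul, Polynomial.eval_C,
      Lagrange.eval_nodal]
    symm
    have hn' := Finset.mem_range.1 hn
    refine (Finset.sum_subset (Finset.range_subset_range.2 (show n + 1 ≤ m + 1 by omega)) ?_).trans ?_
    · intro k _ hk
      rw [Finset.prod_eq_zero (i := n) (by simp at hk ⊢; omega) (sub_self _)]
      ring
    · refine Finset.sum_congr rfl fun k _ => ?_
      have : ∀ i, v n - v i = z i - z n := fun i => by simp only [v]; ring
      simp only [this]
      ring
  have key := Lagrange.coeff_eq_sum hv (P := P) (by rw [Finset.card_range]; exact hdeg)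
  rw [Finset.card_range, Nat.add_sub_cancel, hcoeff] at key
  rw [eq_inv_mul_iff_mul_eq₀ hY0, mul_comm, key]
  refine Finset.sum_congr rfl fun n hn => ?_
  rw [heval n hn, div_eq_mul_inv, Finset.prod_inv_distrib]
  congr 2
  refine Finset.prod_congr rfl fun i _ => ?_
  simp only [v]; ring
end
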